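/- arXiv:1006.1156 — 5 statements merged into one kernel-verified Lean document; each statement's English description precedes it below -/
import Mathlib

section
/- Let G be a finite group acting on the rational function field L(x_1,...,x_n) over a field L such that: (i) σ(L) ⊆ L for all σ ∈ G; (ii) the restriction of the G-action to L is faithful; (iii) for each σ ∈ G, the column vector (σ(x_1),...,σ(x_n))^T equals A(σ)·(x_1,...,x_n)^T + B(σ) for some A(σ) ∈ GL_n(L) and some n×1 matrix B(σ) over L. Then there exist z_1,...,z_n ∈ L(x_1,...,x_n), algebraically independent over L, with L(x_1,...,x_n) = L(z_1,...,z_n) and σ(z_i) = z_i for all σ ∈ G and 1 ≤ i ≤ n. -/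
/-- Galois descent for a finite group of semilinear automorphisms: a stable `L`-subspace `W` of a
field extension `K` of `L` is spanned by its invariants, provided that the group acts faithfully
on `L`. -/
theorem Submodule.le_span_fixed_of_faithful {L K : Type*} [Field L] [Field K] [Algebra L K]
    (G : Subgroup (K ≃+* K)) [Finite G]
    (hL : ∀ σ ∈ G, ∀ l : L, ∃ l' : L, σ (algebraMap L K l) = algebraMap L K l')
    (hfaithful : ∀ σ ∈ G, (∀ l : L, σ (algebraMap L K l) = algebraMap L K l) → σ = 1)
    (W : Submodule L K) (hW : ∀ σ ∈ G, ∀ w ∈ W, σ w ∈ W) :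
    W ≤ Submodule.span L {w : K | w ∈ W ∧ ∀ σ ∈ G, σ w = w} := by
  classical
  have := Fintype.ofFinite G
  intro w hw
  by_contra hnot
  obtain ⟨f, hfw, hf⟩ := Submodule.exists_le_ker_of_notMem hnot
  have htrace : ∀ l : L, ∑ σ : G, σ.1 (algebraMap L K l) * algebraMap L K (f (σ.1 w)) = 0 := by
    intro l
    have hmem : ∑ σ : G, σ.1 (l • w) ∈ {w : K | w ∈ W ∧ ∀ σ ∈ G, σ w = w} := by
      refine ⟨W.sum_mem fun σ _ ↦ hW σ.1 σ.2 _ (W.smul_mem l hw), fun τ hτ ↦ ?_⟩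
      rw [map_sum]
      exact Fintype.sum_equiv (Equiv.mulLeft (⟨τ, hτ⟩ : G)) _ _ fun σ ↦ rfl
    have h0 : f (∑ σ : G, σ.1 (l • w)) = 0 := hf (Submodule.subset_span hmem)
    rw [map_sum] at h0
    have h1 := congrArg (algebraMap L K) h0
    rw [map_sum, map_zero] at h1
    rw [← h1]
    refine Finset.sum_congr rfl fun σ _ ↦ ?_
    obtain ⟨l', hl'⟩ := hL σ.1 σ.2 l
    rw [Algebra.smul_def, map_mul, hl', ← Algebra.smul_def l' (σ.1 w), map_smul, smul_eq_mul, map_mul]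
  let χ : G → (L →* K) := fun σ ↦ (σ.1 : K →* K).comp (algebraMap L K : L →* K)
  have hχ : Function.Injective χ := by
    intro σ τ h
    have h1 : τ⁻¹ * σ = 1 := by
      refine Subtype.ext (hfaithful _ (τ⁻¹ * σ).2 fun l ↦ ?_)
      have h2 : σ.1 (algebraMap L K l) = τ.1 (algebraMap L K l) := DFunLike.congr_fun h l
      change τ.1.symm (σ.1 (algebraMap L K l)) = _
      rw [h2, RingEquiv.symm_apply_apply]
    exact (inv_mul_eq_one.mp h1).symm
  have hind := (linearIndependent_monoidHom L K).comp χ hχ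
  have hzero := Fintype.linearIndependent_iff.mp hind (fun σ ↦ algebraMap L K (f (σ.1 w)))
    (by
      funext l
      rw [Finset.sum_apply, Pi.zero_apply, ← htrace l]
      exact Finset.sum_congr rfl fun σ _ ↦ mul_comm _ _) 1
  exact hfw ((map_eq_zero _).mp hzero)

/-- A spanning set of a subspace of dimension at most `n + 1` that contains `v` can be cut down to
`v` together with `n` elements of the set or zero. -/
theorem Submodule.exists_fin_span_insert {L V : Type*} [Field L] [AddCommGroup V] [Module L V]
    {n : ℕ} (W : Submodule L V) [Module.Finite L W] (hW : Module.finrank L W ≤ n + 1)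
    (S : Set V) (hSW : S ⊆ W) (hWS : W ≤ span L S) {v : V} (hv : v ∈ S) (hv0 : v ≠ 0) :
    ∃ z : Fin n → V, (∀ i, z i ∈ S ∨ z i = 0) ∧ W ≤ span L (insert v (Set.range z)) := by
  classical
  obtain ⟨b, hbS, hvb, hSb, hb⟩ := exists_linearIndepOn_id_extension (K := L) (s := {v}) (t := S)
    (LinearIndepOn.singleton (v := id) hv0) (Set.singleton_subset_iff.mpr hv)
  have hbW : LinearIndependent L (fun x : b ↦ (⟨x, hSW (hbS x.2)⟩ : W)) :=
    LinearIndependent.of_comp W.subtype hb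
  have := hbW.finite
  have := Fintype.ofFinite b
  have hcard : b.toFinset.card ≤ n + 1 := by
    rw [Set.toFinset_card]
    exact hbW.fintype_card_le_finrank.trans hW
  have hvb' : v ∈ b.toFinset := by simpa using hvb
  let t := (b.toFinset.erase v).toList
  have ht : t.length ≤ n := by
    rw [Finset.length_toList, Finset.card_erase_of_mem hvb']
    omega
  refine ⟨fun i ↦ t.getD i 0, fun i ↦ ?_, hWS.trans ((span_le.mpr hSb).trans (span_mono ?_))⟩
  · by_cases hi : (i : ℕ) < t.length
    · left
      have hmem : t[(i : ℕ)] ∈ t := List.getElem_mem hi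
      change t.getD i 0 ∈ S
      rw [List.getD_eq_getElem _ _ hi]
      have hmem' : t[(i : ℕ)] ∈ b.toFinset.erase v := Finset.mem_toList.mp hmem
      exact hbS (Set.mem_toFinset.mp (Finset.mem_of_mem_erase hmem'))
    · right
      exact List.getD_eq_default _ _ (not_lt.mp hi)
  · intro x hx
    by_cases hxv : x = v
    · exact Or.inl hxv
    · right
      have hxt : x ∈ t := Finset.mem_toList.mpr
        (Finset.mem_erase.mpr ⟨hxv, Set.mem_toFinset.mpr hx⟩)
      obtain ⟨i, hi, rfl⟩ := List.mem_iff_getElem.mp hxt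
      exact ⟨⟨i, hi.trans_le ht⟩, List.getD_eq_getElem _ _ hi⟩

/-- In an extension of transcendence degree at least `n`, any `n` field generators are
algebraically independent. -/
theorem AlgebraicIndependent.of_adjoin_eq_top {L K : Type*} [Field L] [Field K] [Algebra L K]
    {n : ℕ} {x : Fin n → K} (hx : AlgebraicIndependent L x) {z : Fin n → K}
    (hz : IntermediateField.adjoin L (Set.range z) = ⊤) : AlgebraicIndependent L z := by
  have : Algebra.IsAlgebraic (Algebra.adjoin L (Set.range z)) K := by
    rw [← IntermediateField.isAlgebraic_adjoin_iff_top, hz]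
    exact ⟨fun a ↦ isAlgebraic_algebraMap (⟨a, trivial⟩ : (⊤ : IntermediateField L K))⟩
  exact (Algebra.IsAlgebraic.isTranscendenceBasis_of_lift_le_trdeg_of_finite L z
    hx.lift_cardinalMk_le_trdeg).1

/-- **(Hajja–Kang)** Let `G` be a finite group of field automorphisms of the rational
function field `L(x_1,…,x_n)` such that (i) every `σ ∈ G` maps `L` into `L`, (ii) the
restriction of the `G`-action to `L` is faithful, and (iii) every `σ ∈ G` acts on the
variables by an affine transformation `(σ(x_1),…,σ(x_n))ᵀ = A(σ)·(x_1,…,x_n)ᵀ + B(σ)`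
with `A(σ) ∈ GL_n(L)`. Then there exist `z_1,…,z_n`, algebraically independent over `L`,
with `L(x_1,…,x_n) = L(z_1,…,z_n)` and `σ(z_i) = z_i` for all `σ ∈ G` and all `i`. -/
theorem stmt_1 (L : Type*) [Field L] (n : ℕ)
    (G : Subgroup (FractionRing (MvPolynomial (Fin n) L) ≃+*
      FractionRing (MvPolynomial (Fin n) L))) [Finite G]
    (hL : ∀ σ ∈ G, ∀ l : L, ∃ l' : L,
      σ (algebraMap L (FractionRing (MvPolynomial (Fin n) L)) l) =
        algebraMap L (FractionRing (MvPolynomial (Fin n) L)) l')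
    (hfaithful : ∀ σ ∈ G,
      (∀ l : L, σ (algebraMap L (FractionRing (MvPolynomial (Fin n) L)) l) =
        algebraMap L (FractionRing (MvPolynomial (Fin n) L)) l) → σ = 1)
    (haffine : ∀ σ ∈ G, ∃ A : Matrix (Fin n) (Fin n) L, ∃ B : Fin n → L,
      IsUnit A.det ∧ ∀ i : Fin n,
        σ (algebraMap (MvPolynomial (Fin n) L) (FractionRing (MvPolynomial (Fin n) L))
            (MvPolynomial.X i)) =
          (∑ j : Fin n, algebraMap L (FractionRing (MvPolynomial (Fin n) L)) (A i j) *
            algebraMap (MvPolynomial (Fin n) L) (FractionRing (MvPolynomial (Fin n) L))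
              (MvPolynomial.X j)) +
          algebraMap L (FractionRing (MvPolynomial (Fin n) L)) (B i)) :
    ∃ z : Fin n → FractionRing (MvPolynomial (Fin n) L),
      AlgebraicIndependent L z ∧
      Subfield.closure
        (Set.range (algebraMap L (FractionRing (MvPolynomial (Fin n) L))) ∪ Set.range z) = ⊤ ∧
      ∀ σ ∈ G, ∀ i : Fin n, σ (z i) = z i := by
  set K := FractionRing (MvPolynomial (Fin n) L)
  let x : Fin n → K := fun i ↦ algebraMap (MvPolynomial (Fin n) L) K (MvPolynomial.X i)
  let W : Submodule L K := Submodule.span L (insert 1 (Set.range x))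
  have h1W : (1 : K) ∈ W := Submodule.subset_span (Set.mem_insert _ _)
  have hxW : ∀ i, x i ∈ W := fun i ↦ Submodule.subset_span (Or.inr ⟨i, rfl⟩)
  have hW : ∀ σ ∈ G, ∀ w ∈ W, σ w ∈ W := by
    intro σ hσ w hw
    induction hw using Submodule.span_induction with
    | mem w hw =>
      rcases hw with rfl | ⟨i, rfl⟩
      · rwa [map_one]
      · obtain ⟨A, B, -, hAB⟩ := haffine σ hσ
        change σ (algebraMap (MvPolynomial (Fin n) L) K (MvPolynomial.X i)) ∈ W
        rw [hAB i]
        refine W.add_mem (W.sum_mem fun j _ ↦ ?_) ?_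
        · rw [← Algebra.smul_def]
          exact W.smul_mem _ (hxW j)
        · rw [Algebra.algebraMap_eq_smul_one]
          exact W.smul_mem _ h1W
    | zero => rw [map_zero]; exact W.zero_mem
    | add a b _ _ ha hb => rw [map_add]; exact W.add_mem ha hb
    | smul l a _ ha =>
      obtain ⟨l', hl'⟩ := hL σ hσ l
      rw [Algebra.smul_def, map_mul, hl', ← Algebra.smul_def]
      exact W.smul_mem _ ha
  have hfin : (insert 1 (Set.range x)).Finite := (Set.finite_range x).insert 1
  have : Module.Finite L W := Module.Finite.span_of_finite L hfin
  have hrank : Module.finrank L W ≤ n + 1 := by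
    classical
    have := hfin.fintype
    refine (finrank_span_le_card (R := L) (insert 1 (Set.range x))).trans ?_
    rw [← Set.ncard_eq_toFinset_card']
    refine (Set.ncard_insert_le _ _).trans (Nat.succ_le_succ ?_)
    rw [← Set.image_univ]
    exact (Set.ncard_image_le Set.finite_univ).trans (by simp)
  obtain ⟨z, hz, hWz⟩ := W.exists_fin_span_insert hrank _ (fun w hw ↦ hw.1)
    (Submodule.le_span_fixed_of_faithful G hL hfaithful W hW)
    (v := 1) ⟨h1W, fun σ _ ↦ map_one σ⟩ one_ne_zero
  have hWF : ∀ w ∈ W, w ∈ IntermediateField.adjoin L (Set.range z) := by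
    intro w hw
    refine (Submodule.span_le (p := Subalgebra.toSubmodule
      (IntermediateField.adjoin L (Set.range z)).toSubalgebra)).mpr ?_ (hWz hw)
    rintro _ (rfl | h)
    · exact one_mem (IntermediateField.adjoin L (Set.range z))
    · exact IntermediateField.subset_adjoin L _ h
  have htop : IntermediateField.adjoin L (Set.range z) = ⊤ := by
    refine eq_top_iff.mpr fun a _ ↦ ?_
    have hpoly : ∀ p : MvPolynomial (Fin n) L,
        algebraMap _ K p ∈ IntermediateField.adjoin L (Set.range z) := by
      intro p
      induction p using MvPolynomial.induction_on with
      | C l => exact (IntermediateField.adjoin L (Set.range z)).algebraMap_mem l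
      | add p q hp hq => rw [map_add]; exact add_mem hp hq
      | mul_X p i hp => rw [map_mul]; exact mul_mem hp (hWF _ (hxW i))
    obtain ⟨p, q, -, rfl⟩ := IsFractionRing.div_surjective (A := MvPolynomial (Fin n) L) a
    exact div_mem (hpoly p) (hpoly q)
  have hx : AlgebraicIndependent L x :=
    (MvPolynomial.algebraicIndependent_X (Fin n) L).map'
      (f := IsScalarTower.toAlgHom L (MvPolynomial (Fin n) L) K)
      (IsFractionRing.injective (MvPolynomial (Fin n) L) K)
  refine ⟨z, hx.of_adjoin_eq_top htop, congrArg IntermediateField.toSubfield htop, ?_⟩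
  intro σ hσ i
  rcases hz i with h | h
  · exact h.2 σ hσ
  · rw [h, map_zero]
end

section
/- Let k be any field and σ the k-automorphism of k(x,y) defined by σ(x) = a/x and σ(y) = b/y, where a ∈ k\{0} and b = c·(x + a/x) + d with c, d ∈ k not both zero. Set u = (x − a/x)/(xy − ab/(xy)) and v = (y − b/y)/(xy − ab/(xy)). Then k(x,y)^⟨σ⟩ = k(u,v). -/
open IntermediateField

theorem exists_eq_add_mul_of_mem_adjoin_quadratic {k K : Type*} [Field k] [Field K] [Algebra k K]
    (E : IntermediateField k K) {x : K} (s t : E) (hx : x ^ 2 - s * x + t = 0) {z : K}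
    (hz : z ∈ E⟮x⟯) : ∃ p q : E, z = p + q * x := by
  let f : Polynomial E := Polynomial.X ^ 2 - Polynomial.C s * Polynomial.X + Polynomial.C t
  have hdeg : f.natDegree = 2 := by
    simp only [f]
    compute_degree!
  have hf : f.Monic := by
    simp only [f]
    monicity!
  have hroot : Polynomial.aeval x f = 0 := by
    simpa [f, IntermediateField.algebraMap_apply] using hx
  have hint : IsIntegral E x := ⟨f, hf, hroot⟩
  rw [← IntermediateField.mem_toSubalgebra,
    IntermediateField.adjoin_simple_toSubalgebra_of_isAlgebraic hint.isAlgebraic,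
    Algebra.adjoin_singleton_eq_range_aeval] at hz
  obtain ⟨g, rfl⟩ := hz
  have hlt : (g %ₘ f).natDegree < 2 := by
    rw [← hdeg]
    exact Polynomial.natDegree_modByMonic_lt g hf fun h => by simp [h] at hdeg
  refine ⟨(g %ₘ f).coeff 0, (g %ₘ f).coeff 1, ?_⟩
  change Polynomial.aeval x g = _
  rw [← Polynomial.aeval_modByMonic_eq_self_of_root hroot,
    Polynomial.aeval_eq_sum_range' hlt]
  simp [Finset.sum_range_succ, Algebra.smul_def, IntermediateField.algebraMap_apply]

theorem fixedField_zpowers_eq_of_quadratic {k K : Type*} [Field k] [Field K] [Algebra k K]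
    (σ : K ≃ₐ[k] K) (E : IntermediateField k K) {x : K} (s t : E)
    (hx : x ^ 2 - s * x + t = 0) (hE : ∀ z ∈ E, σ z = z) (hσx : σ x ≠ x)
    (htop : ∀ z : K, z ∈ E⟮x⟯) : fixedField (Subgroup.zpowers σ) = E := by
  apply le_antisymm
  · intro z hz
    rw [IntermediateField.mem_fixedField_iff] at hz
    have hσz := hz σ (Subgroup.mem_zpowers σ)
    obtain ⟨p, q, rfl⟩ := exists_eq_add_mul_of_mem_adjoin_quadratic E s t hx (htop z)
    rw [map_add, map_mul, hE _ p.2, hE _ q.2] at hσz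
    have hq : (q : K) = 0 := by
      have : (q : K) * (σ x - x) = 0 := by linear_combination hσz
      exact (mul_eq_zero.1 this).resolve_right (sub_ne_zero.2 hσx)
    simp [hq]
  · intro z hz
    rw [IntermediateField.mem_fixedField_iff]
    intro τ hτ
    have hle : Subgroup.zpowers σ ≤ MulAction.stabilizer (K ≃ₐ[k] K) z :=
      (Subgroup.zpowers_le).2 (hE z hz)
    exact hle hτ

theorem mem_of_X_mem {k ι : Type*} [Field k]
    (F : IntermediateField k (FractionRing (MvPolynomial ι k)))
    (hF : ∀ i, algebraMap (MvPolynomial ι k) _ (MvPolynomial.X i) ∈ F)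
    (z : FractionRing (MvPolynomial ι k)) : z ∈ F := by
  have hpoly : ∀ p : MvPolynomial ι k, algebraMap (MvPolynomial ι k) _ p ∈ F := by
    intro p
    induction p using MvPolynomial.induction_on with
    | C r =>
      rw [← MvPolynomial.algebraMap_eq, ← IsScalarTower.algebraMap_apply]
      exact F.algebraMap_mem r
    | add p q hp hq => simpa using F.add_mem hp hq
    | mul_X p i hp => simpa using F.mul_mem hp (hF i)
  obtain ⟨p, q, -, rfl⟩ := IsFractionRing.div_surjective (A := MvPolynomial ι k) z
  exact F.div_mem (hpoly p) (hpoly q)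

/-- An element of `k[x, y]` with a nonzero image in some `k`-algebra is nonzero in `k(x, y)`. -/
theorem algebraMap_fractionRing_ne_zero_of_aeval {k ι R : Type*} [Field k] [CommRing R]
    [Algebra k R] (g : ι → R) {p : MvPolynomial ι k} (hp : MvPolynomial.aeval g p ≠ 0) :
    algebraMap (MvPolynomial ι k) (FractionRing (MvPolynomial ι k)) p ≠ 0 := by
  intro h
  rw [map_eq_zero_iff _ (IsFractionRing.injective (MvPolynomial ι k) _)] at h
  exact hp (by simp [h])

/-- **(Kang)** Let `k` be any field and `σ` the `k`-automorphism of `k(x,y)` defined by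
`σ(x) = a/x`, `σ(y) = b/y`, where `a ∈ k \ {0}` and `b = c·(x + a/x) + d` with `c, d ∈ k`
not both zero.  With `u = (x − a/x)/(xy − ab/(xy))` and `v = (y − b/y)/(xy − ab/(xy))`,
one has `k(x,y)^⟨σ⟩ = k(u,v)`. -/
theorem stmt_2 (k : Type*) [Field k]
    (x y : FractionRing (MvPolynomial (Fin 2) k))
    (hx : x = algebraMap (MvPolynomial (Fin 2) k) _ (MvPolynomial.X 0))
    (hy : y = algebraMap (MvPolynomial (Fin 2) k) _ (MvPolynomial.X 1))
    (a c d : k) (ha : a ≠ 0) (hcd : c ≠ 0 ∨ d ≠ 0)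
    (b : FractionRing (MvPolynomial (Fin 2) k))
    (hb : b = algebraMap k _ c * (x + algebraMap k _ a / x) + algebraMap k _ d)
    (σ : FractionRing (MvPolynomial (Fin 2) k) ≃ₐ[k] FractionRing (MvPolynomial (Fin 2) k))
    (hσx : σ x = algebraMap k _ a / x) (hσy : σ y = b / y)
    (u v : FractionRing (MvPolynomial (Fin 2) k))
    (hu : u = (x - algebraMap k _ a / x) / (x * y - algebraMap k _ a * b / (x * y)))
    (hv : v = (y - b / y) / (x * y - algebraMap k _ a * b / (x * y))) :
    IntermediateField.fixedField (Subgroup.zpowers σ) =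
      IntermediateField.adjoin k {u, v} := by
  have hC : ∀ r : k, algebraMap k (FractionRing (MvPolynomial (Fin 2) k)) r =
      algebraMap (MvPolynomial (Fin 2) k) _ (MvPolynomial.C r) := fun r => by
    rw [← MvPolynomial.algebraMap_eq, ← IsScalarTower.algebraMap_apply]
  have hx0 : x ≠ 0 := by
    rw [hx]
    exact algebraMap_fractionRing_ne_zero_of_aeval (fun _ => (1 : k)) (by simp)
  have hy0 : y ≠ 0 := by
    rw [hy]
    exact algebraMap_fractionRing_ne_zero_of_aeval (fun _ => (1 : k)) (by simp)
  set A := algebraMap k (FractionRing (MvPolynomial (Fin 2) k)) a with hA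
  set C := algebraMap k (FractionRing (MvPolynomial (Fin 2) k)) c with hCc
  set D := algebraMap k (FractionRing (MvPolynomial (Fin 2) k)) d with hD
  have hA0 : A ≠ 0 := by simpa [hA] using ha
  have hxa : x ^ 2 - A ≠ 0 := by
    rw [hx, hA, hC, ← map_pow, ← map_sub]
    refine algebraMap_fractionRing_ne_zero_of_aeval
      (fun _ => (Polynomial.X : Polynomial k)) fun h => ?_
    simpa using congrArg (Polynomial.coeff · 2) h
  have hB0 : C * (x ^ 2 + A) + D * x ≠ 0 := by
    rw [hx, hA, hCc, hD, hC, hC, hC]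
    simp only [← map_pow, ← map_add, ← map_mul]
    refine algebraMap_fractionRing_ne_zero_of_aeval
      (fun _ => (Polynomial.X : Polynomial k)) fun h => ?_
    have h2 := congrArg (Polynomial.coeff · 2) h
    have h1 := congrArg (Polynomial.coeff · 1) h
    simp [Polynomial.coeff_C] at h1 h2
    tauto
  have hden : x ^ 3 * y ^ 2 - A * (C * (x ^ 2 + A) + D * x) ≠ 0 := by
    rw [hx, hy, hA, hCc, hD, hC, hC, hC]
    simp only [← map_pow, ← map_add, ← map_mul, ← map_sub]
    refine algebraMap_fractionRing_ne_zero_of_aeval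
      ![1, (Polynomial.X : Polynomial k)] fun h => ?_
    have h' : (Polynomial.X ^ 2 - Polynomial.C (a * (c * (1 + a) + d)) : Polynomial k) = 0 := by
      rw [← h]
      simp
    exact Polynomial.X_pow_sub_C_ne_zero two_pos _ h'
  have hquartic : (x * y ^ 2 - (C * (x ^ 2 + A) + D * x)) *
      (x ^ 3 * y ^ 2 - A * (C * (x ^ 2 + A) + D * x)) + C * x * (x ^ 2 - A) ^ 2 * y ^ 2 ≠ 0 := by
    rw [hx, hy, hA, hCc, hD, hC, hC, hC]
    simp only [← map_pow, ← map_add, ← map_mul, ← map_sub]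
    refine algebraMap_fractionRing_ne_zero_of_aeval
      ![1, (Polynomial.X : Polynomial k)] fun h => ?_
    let B := c * (1 + a) + d
    have h' : (Polynomial.X ^ 4 + Polynomial.C (c * (1 - a) ^ 2 - B - a * B) * Polynomial.X ^ 2 +
        Polynomial.C (a * B ^ 2) : Polynomial k) = 0 := by
      rw [← h]
      simp [B]
      ring
    generalize c * (1 - a) ^ 2 - B - a * B = p, a * B ^ 2 = q at h'
    simpa [Polynomial.coeff_C, Polynomial.coeff_X_pow] using congrArg (Polynomial.coeff · 4) h'
  have hbx : b * x = C * (x ^ 2 + A) + D * x := by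
    rw [hb]; field_simp
  have hb0 : b ≠ 0 := fun h => hB0 (by rw [← hbx, h, zero_mul])
  have hσA : σ A = A := σ.commutes a
  have hσb : σ b = b := by
    rw [hb]
    simp only [map_add, map_mul, map_div₀, hσx, hσA, hCc, hD, AlgEquiv.commutes]
    field_simp
    ring
  have hden' : x * y - A * b / (x * y) ≠ 0 := by
    intro h
    apply hden
    rw [← hbx]
    field_simp at h
    linear_combination x * h
  have hu0 : u ≠ 0 := by
    rw [hu]
    refine div_ne_zero (fun h => hxa ?_) hden'
    field_simp at h
    simpa using h
  have hdenσ : σ (x * y - A * b / (x * y)) = -(x * y - A * b / (x * y)) := by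
    simp only [map_sub, map_mul, map_div₀, hσx, hσy, hσA, hσb]
    field_simp
    ring
  have hσu : σ u = u := by
    rw [hu, map_div₀, hdenσ, map_sub, map_div₀, hσx, hσA, div_div_cancel₀ hA0, ← neg_sub,
      neg_div_neg_eq]
  have hσv : σ v = v := by
    rw [hv, map_div₀, hdenσ, map_sub, map_div₀, hσy, hσb, div_div_cancel₀ hb0, ← neg_sub,
      neg_div_neg_eq]
  have hvu : v + C * u ^ 2 ≠ 0 := by
    intro h
    apply hquartic
    have h1 : (y - b / y) * (x * y - A * b / (x * y)) + C * (x - A / x) ^ 2 = 0 := by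
      rw [hu, hv] at h
      generalize x * y - A * b / (x * y) = e at *
      field_simp at h
      field_simp
      linear_combination h
    rw [← hbx]
    field_simp at h1
    linear_combination x * h1
  have hYu : x * v + b / y * u = 1 := by
    rw [hu, hv, ← mul_div_assoc, ← mul_div_assoc, ← add_div, div_eq_one_iff_eq hden']
    field_simp
    ring
  have hyu : A / x * v + y * u = 1 := by
    rw [hu, hv, ← mul_div_assoc, ← mul_div_assoc, ← add_div, div_eq_one_iff_eq hden']
    field_simp
    ring
  have hs : x + A / x = (1 + A * v ^ 2 - D * u ^ 2) / (v + C * u ^ 2) := by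
    rw [eq_div_iff hvu]
    have hbu : b * u ^ 2 = (1 - x * v) * (1 - A / x * v) := by
      rw [← hYu]
      nth_rewrite 2 [hYu]
      rw [← hyu]
      field_simp
      ring
    rw [hb] at hbu
    have hxX : x * (A / x) = A := mul_div_cancel₀ A hx0
    linear_combination hbu + v ^ 2 * hxX
  set E := IntermediateField.adjoin k {u, v} with hE
  have huE : u ∈ E := IntermediateField.subset_adjoin k _ (by simp)
  have hvE : v ∈ E := IntermediateField.subset_adjoin k _ (by simp)
  have hkE : ∀ r : k, algebraMap k (FractionRing (MvPolynomial (Fin 2) k)) r ∈ E :=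
    E.algebraMap_mem
  have hsE : x + A / x ∈ E := by
    rw [hs]
    exact E.div_mem (E.sub_mem (E.add_mem E.one_mem (E.mul_mem (hkE a) (E.pow_mem hvE 2)))
      (E.mul_mem (hkE d) (E.pow_mem huE 2)))
      (E.add_mem hvE (E.mul_mem (hkE c) (E.pow_mem huE 2)))
  refine fixedField_zpowers_eq_of_quadratic σ E (x := x) ⟨_, hsE⟩ ⟨A, hkE a⟩ ?_ ?_ ?_ ?_
  · change x ^ 2 - (x + A / x) * x + A = 0
    field_simp
    ring
  · intro z hz
    induction hz using IntermediateField.adjoin_induction with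
    | mem z hz =>
      rcases hz with rfl | rfl
      · exact hσu
      · exact hσv
    | algebraMap r => exact σ.commutes r
    | add z w _ _ hz hw => rw [map_add, hz, hw]
    | inv z _ hz => rw [map_inv₀, hz]
    | mul z w _ _ hz hw => rw [map_mul, hz, hw]
  · intro h
    rw [hσx, div_eq_iff hx0] at h
    exact hxa (by rw [h]; ring)
  · have hEF : ∀ z ∈ E, z ∈ E⟮x⟯ := fun z hz => E⟮x⟯.algebraMap_mem ⟨z, hz⟩
    have hxF : x ∈ E⟮x⟯ := IntermediateField.mem_adjoin_simple_self E x
    have hyF : y ∈ E⟮x⟯ := by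
      have : y = (1 - A / x * v) / u := by
        rw [eq_div_iff hu0]
        linear_combination hyu
      rw [this]
      exact div_mem (sub_mem (one_mem _) (mul_mem (div_mem (hEF _ (hkE a)) hxF) (hEF v hvE)))
        (hEF u huE)
    intro z
    rw [← IntermediateField.mem_restrictScalars k]
    refine mem_of_X_mem _ (fun i => ?_) z
    rw [IntermediateField.mem_restrictScalars]
    fin_cases i
    · exact hx ▸ hxF
    · exact hy ▸ hyF
end

section
/- Let k be any field and G a finite subgroup of GL_3(ℚ) (realized in GL_3(ℤ)) that is reducible over ℚ, acting linearly on ℚ(x_1, x_2, x_3) with the invariant decomposition σ·x_1, σ·x_2 ∈ ℚx_1 ⊕ ℚx_2 and σ·x_3 ∈ ℚx_3 for all σ ∈ G. Then ℚ(x_1, x_2, x_3)^G is rational (purely transcendental) over ℚ. -/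
open IntermediateField

section GeneratingFamilies

universe u v w

open scoped algebraAdjoinAdjoin

variable {F : Type u} {E : Type v} {ι : Type w} [Field F] [Field E] [Algebra F E]

theorem AlgebraicIndependent.transcendental_intermediateField_adjoin {x : ι → E}
    (hx : AlgebraicIndependent F x) {s : Set ι} {i : ι} (hi : i ∉ s) :
    Transcendental (adjoin F (x '' s)) (x i) := by
  intro h
  exact hx.transcendental_adjoin hi ((IsFractionRing.isAlgebraic_iff
    (Algebra.adjoin F (x '' s)) (adjoin F (x '' s)) E).mpr h)

/-- A family of at most `trdeg F E` elements generating a field over which `E` is algebraic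
is algebraically independent. -/
theorem algebraicIndependent_of_isAlgebraic_adjoin_range [Finite ι] (x : ι → E)
    [Algebra.IsAlgebraic (adjoin F (Set.range x)) E]
    (h : Cardinal.lift.{v} (Cardinal.mk ι) ≤ Cardinal.lift.{w} (Algebra.trdeg F E)) :
    AlgebraicIndependent F x := by
  have : Algebra.IsAlgebraic (Algebra.adjoin F (Set.range x)) E :=
    (IsFractionRing.comap_isAlgebraic_iff (K := adjoin F (Set.range x))).mpr inferInstance
  exact (Algebra.IsAlgebraic.isTranscendenceBasis_of_lift_le_trdeg_of_finite F x h).1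

/-- Lüroth's theorem inside an arbitrary field extension. -/
theorem exists_eq_adjoin_simple_of_le_adjoin_simple {z : E} (hz : Transcendental F z)
    {M : IntermediateField F E} (hM : M ≤ F⟮z⟯) : ∃ t, M = F⟮t⟯ := by
  let e := RatFunc.algEquivOfTranscendental z hz
  let φ : RatFunc F →ₐ[F] E := F⟮z⟯.val.comp e.toAlgHom
  have hφ : φ.fieldRange = F⟮z⟯ := by
    ext y
    refine ⟨?_, fun hy ↦ ⟨e.symm ⟨y, hy⟩, by simp [φ]⟩⟩
    rintro ⟨r, rfl⟩
    exact (e r).2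
  have hmap : (M.comap φ).map φ = M := by
    ext y
    refine ⟨?_, fun hy ↦ ?_⟩
    · rintro ⟨r, hr, rfl⟩
      exact hr
    · obtain ⟨r, rfl⟩ : y ∈ φ.fieldRange := hφ ▸ hM hy
      exact ⟨r, hy, rfl⟩
  refine ⟨φ (RatFunc.Luroth.generator (M.comap φ)), ?_⟩
  rw [← Set.image_singleton, ← adjoin_map, ← RatFunc.Luroth.eq_adjoin_generator, hmap]

end GeneratingFamilies

section FixedFields

variable {F E : Type*} [Field F] [Field E] [Algebra F E]
  (G : Subgroup (E ≃ₐ[F] E)) (L : IntermediateField F E)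

instance [Finite G] : Algebra.IsAlgebraic (fixedField G) E :=
  have : Algebra.IsInvariant (fixedField G) E G := ⟨fun b hb ↦ ⟨⟨b, hb⟩, rfl⟩⟩
  have := Algebra.IsInvariant.isIntegral (fixedField G) E G
  inferInstance

variable {G L} {y : E}

theorem apply_aeval_mem_adjoin {σ : E ≃ₐ[F] E} (hL : ∀ x ∈ L, σ x ∈ L)
    (hσ : ∃ c ∈ L, σ y = c * y) {p : E} (hp : p ∈ Algebra.adjoin L {y}) :
    σ p ∈ Algebra.adjoin L {y} := by
  induction hp using Algebra.adjoin_induction with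
  | mem x hx =>
    obtain ⟨c, hc, h⟩ := hσ
    rw [Set.mem_singleton_iff.mp hx, h]
    exact mul_mem (algebraMap_mem _ (⟨c, hc⟩ : L)) (Algebra.self_mem_adjoin_singleton _ _)
  | algebraMap r => exact algebraMap_mem _ (⟨σ r, hL r r.2⟩ : L)
  | add a b _ _ ha hb => rw [map_add]; exact add_mem ha hb
  | mul a b _ _ ha hb => rw [map_mul]; exact mul_mem ha hb

/-- Every term of a polynomial in `y` fixed by a semilinear scaling of `y` is fixed. -/
theorem apply_coeff_mul_pow_of_apply_aeval {σ : E ≃ₐ[F] E} (hy : Transcendental L y)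
    (hL : ∀ x ∈ L, σ x ∈ L) (hσ : ∃ c ∈ L, σ y = c * y) {p : Polynomial L}
    (hp : σ (Polynomial.aeval y p) = Polynomial.aeval y p) (i : ℕ) :
    σ (p.coeff i * y ^ i) = p.coeff i * y ^ i := by
  obtain ⟨c, hc, h⟩ := hσ
  let τ : L → ℕ → L := fun a i ↦ ⟨σ a * c ^ i, mul_mem (hL a a.2) (pow_mem hc i)⟩
  have hτ0 (i : ℕ) : τ 0 i = 0 := Subtype.ext (by simp [τ])
  have hτ : p.sum (fun i a ↦ Polynomial.monomial i (τ a i)) = p := by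
    refine transcendental_iff_injective.mp hy ?_
    rw [← hp, Polynomial.aeval_eq_sum_range (p := p), Polynomial.sum_over_range _ (by simp [hτ0]), map_sum,
      map_sum]
    refine Finset.sum_congr rfl fun i _ ↦ ?_
    simp only [Polynomial.aeval_monomial, Algebra.smul_def, map_mul, map_pow, h, mul_pow]
    simp only [IntermediateField.algebraMap_apply, τ]
    ring
  have hcoeff : τ (p.coeff i) i = p.coeff i := by
    conv_rhs => rw [← hτ]
    rw [Polynomial.sum_over_range _ (by simp [hτ0]), Polynomial.finsetSum_coeff]
    simp only [Polynomial.coeff_monomial, Finset.sum_ite_eq', Finset.mem_range]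
    split_ifs with hi
    · rfl
    · rw [Polynomial.coeff_eq_zero_of_natDegree_lt (by omega)]
      exact hτ0 i
  rw [map_mul, map_pow, h, mul_pow, ← mul_assoc]
  exact congrArg (fun a : L ↦ (a : E) * y ^ i) hcoeff

/-- Elements of `L(y)` fixed by a finite group are quotients of fixed elements of `L[y]`. -/
theorem exists_fixed_div_of_mem_adjoin_simple [Finite G] (hL : ∀ σ ∈ G, ∀ x ∈ L, σ x ∈ L)
    (hG : ∀ σ ∈ G, ∃ c ∈ L, σ y = c * y) {f : E} (hf : f ∈ L⟮y⟯) (hfG : f ∈ fixedField G) :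
    ∃ p ∈ Algebra.adjoin L {y}, ∃ q ∈ Algebra.adjoin L {y},
      p ∈ fixedField G ∧ q ∈ fixedField G ∧ f = p / q := by
  classical
  have := Fintype.ofFinite G
  obtain ⟨r, s, rfl⟩ := (mem_adjoin_simple_iff L f).mp hf
  have hmem (t : Polynomial L) : Polynomial.aeval y t ∈ Algebra.adjoin L {y} :=
    Polynomial.aeval_mem_adjoin_singleton _ _
  generalize hP : Polynomial.aeval y r = P at *
  generalize hQ : Polynomial.aeval y s = Q at *
  have hPm : P ∈ Algebra.adjoin L {y} := hP ▸ hmem r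
  have hQm : Q ∈ Algebra.adjoin L {y} := hQ ▸ hmem s
  by_cases hQ0 : Q = 0
  · exact ⟨0, zero_mem _, 0, zero_mem _, zero_mem _, zero_mem _, by simp [hQ0]⟩
  have hst (σ : G) : (σ : E ≃ₐ[F] E) Q ∈ Algebra.adjoin L {y} :=
    apply_aeval_mem_adjoin (hL σ σ.2) (hG σ σ.2) hQm
  let N : E := ∏ σ : G, (σ : E ≃ₐ[F] E) Q
  have hN0 : N ≠ 0 := Finset.prod_ne_zero_iff.mpr fun σ _ ↦ by simpa using hQ0
  have hNG : N ∈ fixedField G := by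
    rw [mem_fixedField_iff]
    intro σ hσ
    rw [map_prod]
    exact Fintype.prod_equiv (Equiv.mulLeft (⟨σ, hσ⟩ : G)) _ _ fun τ ↦ rfl
  have hN : N = Q * ∏ σ ∈ Finset.univ.erase (1 : G), (σ : E ≃ₐ[F] E) Q :=
    (Finset.mul_prod_erase _ _ (Finset.mem_univ (1 : G))).symm
  refine ⟨P / Q * N, ?_, N, prod_mem fun σ _ ↦ hst σ, mul_mem hfG hNG, hNG,
    (mul_div_cancel_right₀ _ hN0).symm⟩
  rw [hN, ← mul_assoc, div_mul_cancel₀ _ hQ0]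
  exact mul_mem hPm (prod_mem fun σ _ ↦ hst σ)

variable (G L y) in
/-- The exponents `i` for which some nonzero multiple of `y ^ i` by an element of `L` is fixed
by `G`. -/
def fixedExponents (hy : y ≠ 0) : AddSubgroup ℤ where
  carrier := {i | ∃ a ∈ L, a ≠ 0 ∧ a * y ^ i ∈ fixedField G}
  zero_mem' := ⟨1, one_mem _, one_ne_zero, by simp⟩
  add_mem' := by
    rintro i j ⟨a, ha, ha0, hai⟩ ⟨b, hb, hb0, hbj⟩
    refine ⟨a * b, mul_mem ha hb, mul_ne_zero ha0 hb0, ?_⟩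
    rw [zpow_add₀ hy, mul_mul_mul_comm]
    exact mul_mem hai hbj
  neg_mem' := by
    rintro i ⟨a, ha, ha0, hai⟩
    refine ⟨a⁻¹, inv_mem ha, inv_ne_zero ha0, ?_⟩
    rw [zpow_neg, ← mul_inv]
    exact inv_mem hai

/-- If a finite group `G` stabilises `L` and scales `y` by elements of `L`, then the fixed field
of `L(y)` is generated by one element over the fixed field of `L`. -/
theorem exists_adjoin_simple_inf_fixedField [Finite G] (hy : Transcendental L y)
    (hL : ∀ σ ∈ G, ∀ x ∈ L, σ x ∈ L) (hG : ∀ σ ∈ G, ∃ c ∈ L, σ y = c * y) :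
    ∃ u, L⟮y⟯.restrictScalars F ⊓ fixedField G = (L ⊓ fixedField G) ⊔ F⟮u⟯ := by
  have hy0 : y ≠ 0 := fun h ↦ hy (h ▸ isAlgebraic_zero)
  obtain ⟨n, hn⟩ := Int.subgroup_cyclic (fixedExponents G L y hy0)
  obtain ⟨a, ha, ha0, hu⟩ : n ∈ fixedExponents G L y hy0 :=
    hn ▸ AddSubgroup.subset_closure rfl
  have hLy : L ≤ L⟮y⟯.restrictScalars F := fun x hx ↦ L⟮y⟯.algebraMap_mem ⟨x, hx⟩
  refine ⟨a * y ^ n, le_antisymm ?_ (sup_le (inf_le_inf_right _ hLy) ?_)⟩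
  · set K := (L ⊓ fixedField G) ⊔ F⟮a * y ^ n⟯ with hK
    have huK : a * y ^ n ∈ K := (le_sup_right : _ ≤ K) (mem_adjoin_simple_self F _)
    have hpoly {p : E} (hp : p ∈ Algebra.adjoin L {y}) (hpG : p ∈ fixedField G) : p ∈ K := by
      rw [Algebra.adjoin_singleton_eq_range_aeval] at hp
      obtain ⟨r, rfl⟩ := hp
      change Polynomial.aeval y r ∈ K
      rw [Polynomial.aeval_eq_sum_range]
      refine sum_mem fun i _ ↦ ?_
      rw [Algebra.smul_def]
      change (r.coeff i : E) * y ^ i ∈ K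
      by_cases hr : (r.coeff i : E) = 0
      · rw [hr, zero_mul]
        exact zero_mem _
      have hfix : (r.coeff i : E) * y ^ i ∈ fixedField G :=
        (mem_fixedField_iff ..).mpr fun σ hσ ↦ apply_coeff_mul_pow_of_apply_aeval hy (hL σ hσ)
          (hG σ hσ) ((mem_fixedField_iff ..).mp hpG σ hσ) i
      have hi : (i : ℤ) ∈ fixedExponents G L y hy0 :=
        ⟨r.coeff i, (r.coeff i).2, hr, by rwa [zpow_natCast]⟩
      rw [hn, AddSubgroup.mem_closure_singleton] at hi
      obtain ⟨k, hk⟩ := hi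
      have hpow : y ^ i = y ^ (n * k) := by rw [← zpow_natCast, ← hk, smul_eq_mul, mul_comm]
      have hb : (r.coeff i : E) * y ^ i = r.coeff i / a ^ k * (a * y ^ n) ^ k := by
        rw [hpow, mul_zpow, ← zpow_mul]
        field_simp
      have hbG : (r.coeff i : E) / a ^ k ∈ fixedField G := by
        have : (r.coeff i : E) / a ^ k = r.coeff i * y ^ i / (a * y ^ n) ^ k := by
          rw [hb, mul_div_cancel_right₀]
          exact zpow_ne_zero _ (mul_ne_zero ha0 (zpow_ne_zero _ hy0))
        rw [this]
        exact div_mem hfix (zpow_mem hu k)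
      rw [hb]
      exact mul_mem ((le_sup_left : _ ≤ K) ⟨div_mem (r.coeff i).2 (zpow_mem ha k), hbG⟩)
        (zpow_mem huK k)
    rintro f ⟨hf, hfG⟩
    obtain ⟨p, hp, q, hq, hpG, hqG, rfl⟩ := exists_fixed_div_of_mem_adjoin_simple hL hG hf hfG
    exact div_mem (hpoly hp hpG) (hpoly hq hqG)
  · rw [adjoin_simple_le_iff]
    exact ⟨mul_mem (hLy ha) (zpow_mem (mem_adjoin_simple_self L y) n), hu⟩

end FixedFields

/-- Rationality of the fixed field of a finite group acting on the rational function field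
`F(x₁, x₂, x₃)` by linear substitutions preserving `Fx₁ ⊕ Fx₂` and `Fx₃`. -/
theorem exists_adjoin_range_eq_fixedField {F E : Type*} [Field F] [Field E] [Algebra F E]
    {x₁ x₂ x₃ : E} (hx : AlgebraicIndependent F ![x₁, x₂, x₃])
    (htop : adjoin F {x₁, x₂, x₃} = ⊤) (G : Subgroup (E ≃ₐ[F] E)) [Finite G]
    (hred : ∀ σ ∈ G, ∃ a b c d e : F,
      σ x₁ = algebraMap F E a * x₁ + algebraMap F E b * x₂ ∧
      σ x₂ = algebraMap F E c * x₁ + algebraMap F E d * x₂ ∧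
      σ x₃ = algebraMap F E e * x₃) :
    ∃ t : Fin 3 → E, AlgebraicIndependent F t ∧ adjoin F (Set.range t) = fixedField G := by
  have hx₂ : x₂ ≠ 0 := hx.ne_zero 1
  have htrdeg : Cardinal.lift (Cardinal.mk (Fin 3)) ≤ Cardinal.lift (Algebra.trdeg F E) :=
    hx.lift_cardinalMk_le_trdeg
  set z := x₁ / x₂ with hz
  have hx₁ : x₁ = z * x₂ := (div_mul_cancel₀ _ hx₂).symm
  have hztop : adjoin F (Set.range ![z, x₂, x₃]) = ⊤ := by
    rw [eq_top_iff, ← htop, adjoin_le_iff]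
    have hmem (i : Fin 3) : ![z, x₂, x₃] i ∈ adjoin F (Set.range ![z, x₂, x₃]) :=
      subset_adjoin _ _ ⟨i, rfl⟩
    rintro _ (rfl | rfl | rfl)
    · rw [hx₁]
      exact mul_mem (hmem 0) (hmem 1)
    · exact hmem 1
    · exact hmem 2
  have hind : AlgebraicIndependent F ![z, x₂, x₃] := by
    have : Algebra.IsAlgebraic (adjoin F (Set.range ![z, x₂, x₃])) E := by
      rw [hztop]
      exact ⟨fun a ↦ isAlgebraic_algebraMap (⟨a, mem_top⟩ : (⊤ : IntermediateField F E))⟩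
    exact algebraicIndependent_of_isAlgebraic_adjoin_range _ htrdeg
  have hzx₂ : Transcendental F⟮z⟯ x₂ := by
    have := hind.transcendental_intermediateField_adjoin (s := {0}) (i := 1) (by simp)
    rwa [Set.image_singleton] at this
  set L := F⟮z⟯⟮x₂⟯.restrictScalars F with hL
  have hLadj : L = adjoin F {z, x₂} := by
    rw [hL, restrictScalars_adjoin_eq_sup, ← adjoin_union, Set.singleton_union]
  have hzx₃ : Transcendental L x₃ := by
    have := hind.transcendental_intermediateField_adjoin (s := {0, 1}) (i := 2) (by simp)
    rw [Set.image_pair] at this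
    rw [hLadj]
    exact this
  have hLtop : L⟮x₃⟯.restrictScalars F = ⊤ := by
    rw [restrictScalars_adjoin_eq_sup, hLadj, ← adjoin_union, ← hztop]
    congr 1
    ext w
    simp only [Set.mem_union, Set.mem_insert_iff, Set.mem_singleton_iff, Matrix.range_cons,
      Matrix.range_empty, Set.union_empty]
    tauto
  have hscale : ∀ σ ∈ G, ∃ c ∈ F⟮z⟯, σ x₂ = c * x₂ := by
    intro σ hσ
    obtain ⟨a, b, c, d, e, -, h, -⟩ := hred σ hσ
    refine ⟨algebraMap F E c * z + algebraMap F E d, ?_, by rw [h, hx₁]; ring⟩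
    exact add_mem (mul_mem (F⟮z⟯.algebraMap_mem _) (mem_adjoin_simple_self F z)) (F⟮z⟯.algebraMap_mem _)
  have hstab₁ : ∀ σ ∈ G, ∀ w ∈ F⟮z⟯, σ w ∈ F⟮z⟯ := by
    intro σ hσ
    suffices F⟮z⟯ ≤ F⟮z⟯.comap (σ : E →ₐ[F] E) from this
    rw [adjoin_simple_le_iff]
    change σ z ∈ F⟮z⟯
    obtain ⟨a, b, c, d, e, h₁, -, -⟩ := hred σ hσ
    obtain ⟨l, hl, h₂⟩ := hscale σ hσ
    have : σ z = (algebraMap F E a * z + algebraMap F E b) / l := by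
      rw [hz, map_div₀, ← hz, h₁, h₂, hx₁, ← mul_assoc, ← add_mul, mul_div_mul_right _ _ hx₂]
    rw [this]
    exact div_mem (add_mem (mul_mem (F⟮z⟯.algebraMap_mem _) (mem_adjoin_simple_self F z))
      (F⟮z⟯.algebraMap_mem _)) hl
  have hle : F⟮z⟯ ≤ L := fun w hw ↦ F⟮z⟯⟮x₂⟯.algebraMap_mem ⟨w, hw⟩
  have hx₂L : x₂ ∈ L := mem_adjoin_simple_self F⟮z⟯ x₂
  have hstab₂ : ∀ σ ∈ G, ∀ w ∈ L, σ w ∈ L := by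
    intro σ hσ
    suffices L ≤ L.comap (σ : E →ₐ[F] E) from this
    conv_lhs => rw [hLadj]
    rw [adjoin_le_iff]
    rintro w (rfl | hw)
    · exact hle (hstab₁ σ hσ _ (mem_adjoin_simple_self F z))
    · rw [Set.mem_singleton_iff.mp hw]
      change σ x₂ ∈ L
      obtain ⟨c, hc, h⟩ := hscale σ hσ
      rw [h]
      exact mul_mem (hle hc) hx₂L
  obtain ⟨t, ht⟩ := exists_eq_adjoin_simple_of_le_adjoin_simple (hind.transcendental 0)
    (inf_le_left : F⟮z⟯ ⊓ fixedField G ≤ F⟮z⟯)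
  obtain ⟨u, hu⟩ := exists_adjoin_simple_inf_fixedField hzx₂ hstab₁ hscale
  obtain ⟨v, hv⟩ := exists_adjoin_simple_inf_fixedField (G := G) hzx₃ hstab₂ fun σ hσ ↦ by
    obtain ⟨a, b, c, d, e, -, -, h⟩ := hred σ hσ
    exact ⟨_, L.algebraMap_mem e, h⟩
  have hgen : adjoin F (Set.range ![t, u, v]) = fixedField G := by
    rw [hLtop, top_inf_eq, hu, ht, ← adjoin_union, ← adjoin_union] at hv
    rw [hv]
    congr 1
    ext w
    simp only [Set.mem_union, Set.mem_singleton_iff, Matrix.range_cons,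
      Matrix.range_empty, Set.union_empty]
    tauto
  have : Algebra.IsAlgebraic (adjoin F (Set.range ![t, u, v])) E := by
    rw [hgen]
    infer_instance
  exact ⟨_, algebraicIndependent_of_isAlgebraic_adjoin_range _ htrdeg, hgen⟩

theorem adjoin_range_algebraMap_X {F σ K : Type*} [Field F] [Field K] [Algebra F K]
    [Algebra (MvPolynomial σ F) K] [IsScalarTower F (MvPolynomial σ F) K]
    [IsFractionRing (MvPolynomial σ F) K] :
    adjoin F (Set.range fun i : σ ↦ algebraMap (MvPolynomial σ F) K (MvPolynomial.X i)) = ⊤ := by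
  set L := adjoin F (Set.range fun i : σ ↦ algebraMap (MvPolynomial σ F) K (MvPolynomial.X i))
  have hpoly (p : MvPolynomial σ F) : algebraMap _ K p ∈ L := by
    induction p using MvPolynomial.induction_on with
    | C a =>
      rw [← MvPolynomial.algebraMap_eq, ← IsScalarTower.algebraMap_apply]
      exact L.algebraMap_mem a
    | add p q hp hq => rw [map_add]; exact add_mem hp hq
    | mul_X p i hp => rw [map_mul]; exact mul_mem hp (subset_adjoin _ _ ⟨i, rfl⟩)
  rw [eq_top_iff]
  intro f _
  obtain ⟨p, q, -, rfl⟩ := IsFractionRing.div_surjective (A := MvPolynomial σ F) f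
  exact div_mem (hpoly p) (hpoly q)

/-- Let `G` be a finite group of `ℚ`-automorphisms of `ℚ(x₁,x₂,x₃)` acting by linear
substitutions which are reducible: `σ·x₁, σ·x₂ ∈ ℚx₁ ⊕ ℚx₂` and `σ·x₃ ∈ ℚx₃` for every
`σ ∈ G`.  Then `ℚ(x₁,x₂,x₃)^G` is rational (purely transcendental) over `ℚ`. -/
theorem stmt_16
    (x₁ x₂ x₃ : FractionRing (MvPolynomial (Fin 3) ℚ))
    (hx₁ : x₁ = algebraMap (MvPolynomial (Fin 3) ℚ) _ (MvPolynomial.X 0))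
    (hx₂ : x₂ = algebraMap (MvPolynomial (Fin 3) ℚ) _ (MvPolynomial.X 1))
    (hx₃ : x₃ = algebraMap (MvPolynomial (Fin 3) ℚ) _ (MvPolynomial.X 2))
    (G : Subgroup (FractionRing (MvPolynomial (Fin 3) ℚ) ≃ₐ[ℚ]
      FractionRing (MvPolynomial (Fin 3) ℚ))) [Finite G]
    (hred : ∀ σ ∈ G, ∃ a b c d e : ℚ,
      σ x₁ = algebraMap ℚ _ a * x₁ + algebraMap ℚ _ b * x₂ ∧
      σ x₂ = algebraMap ℚ _ c * x₁ + algebraMap ℚ _ d * x₂ ∧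
      σ x₃ = algebraMap ℚ _ e * x₃) :
    ∃ t : Fin 3 → FractionRing (MvPolynomial (Fin 3) ℚ),
      AlgebraicIndependent ℚ t ∧
      IntermediateField.adjoin ℚ (Set.range t) = IntermediateField.fixedField G := by
  have hx : ![x₁, x₂, x₃] = fun i ↦ algebraMap (MvPolynomial (Fin 3) ℚ)
      (FractionRing (MvPolynomial (Fin 3) ℚ)) (MvPolynomial.X i) := by
    ext i
    fin_cases i
    exacts [hx₁, hx₂, hx₃]
  have hind : AlgebraicIndependent ℚ ![x₁, x₂, x₃] := by
    rw [hx]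
    exact (MvPolynomial.algebraicIndependent_X (Fin 3) ℚ).map'
      (f := IsScalarTower.toAlgHom ℚ _ _) (IsFractionRing.injective _ _)
  have htop : adjoin ℚ {x₁, x₂, x₃} = ⊤ := by
    rw [← adjoin_range_algebraMap_X (F := ℚ) (σ := Fin 3), ← hx]
    congr 1
    ext w
    simp only [Set.mem_union, Set.mem_insert_iff, Set.mem_singleton_iff, Matrix.range_cons,
      Matrix.range_empty, Set.union_empty]
  exact exists_adjoin_range_eq_fixedField hind htop G hred
end

section
/- Let k be a field with char k ≠ 2, 3, E an indeterminate, and set a = 9E(1 + E), c = −12E, d = 4(1 − 9E − 18E²). Let λ be the k(E)-automorphism of k(E)(t_2, t_3) defined by λ(t_2) = a/t_2 and λ(t_3) = (c(t_2 + a/t_2) + d)/t_3. Then k(E)(t_2, t_3)^⟨λ⟩ is rational over k(E), hence k(E, t_2, t_3)^⟨λ⟩ is purely transcendental of degree 3 over k. -/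
open IntermediateField

section

variable {k L : Type*} [Field k] [Field L] [Algebra k L]

/-- If `L` is generated over `K` by an element `x` which is quadratic over `K` with conjugate
`σ x ≠ x`, then the fixed field of `σ` is `K`. -/
theorem fixedField_zpowers_eq_of_quadratic_s17 (K : IntermediateField k L) (σ : L ≃ₐ[k] L) (x : L)
    (hK : ∀ z ∈ K, σ z = z) (hsum : x + σ x ∈ K) (hprod : x * σ x ∈ K) (hx : σ x ≠ x)
    (hint : IsIntegral K x) (htop : IntermediateField.adjoin K {x} = ⊤) :
    IntermediateField.fixedField (Subgroup.zpowers σ) = K := by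
  have hspan : ∀ z : L, ∃ p ∈ K, ∃ q ∈ K, z = p + q * x := by
    intro z
    have hz : z ∈ Algebra.adjoin K {x} := by
      rw [← IntermediateField.adjoin_simple_toSubalgebra_of_isAlgebraic hint.isAlgebraic, htop]
      trivial
    induction hz using Algebra.adjoin_induction with
    | mem z hz => exact ⟨0, K.zero_mem, 1, K.one_mem, by simp_all⟩
    | algebraMap r => exact ⟨r, r.2, 0, K.zero_mem, by simp⟩
    | add _ _ _ _ h₁ h₂ =>
      obtain ⟨p, hp, q, hq, rfl⟩ := h₁
      obtain ⟨r, hr, s, hs, rfl⟩ := h₂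
      exact ⟨p + r, K.add_mem hp hr, q + s, K.add_mem hq hs, by ring⟩
    | mul _ _ _ _ h₁ h₂ =>
      obtain ⟨p, hp, q, hq, rfl⟩ := h₁
      obtain ⟨r, hr, s, hs, rfl⟩ := h₂
      exact ⟨p * r - q * s * (x * σ x),
        K.sub_mem (K.mul_mem hp hr) (K.mul_mem (K.mul_mem hq hs) hprod),
        p * s + q * r + q * s * (x + σ x),
        K.add_mem (K.add_mem (K.mul_mem hp hs) (K.mul_mem hq hr))
          (K.mul_mem (K.mul_mem hq hs) hsum), by ring⟩
  ext z
  rw [IntermediateField.mem_fixedField_iff]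
  constructor
  · intro h
    obtain ⟨p, hp, q, hq, rfl⟩ := hspan z
    have h₁ := h σ (Subgroup.mem_zpowers σ)
    rw [map_add, map_mul, hK p hp, hK q hq] at h₁
    have h₂ : q * (σ x - x) = 0 := by linear_combination h₁
    rcases mul_eq_zero.mp h₂ with h₃ | h₃
    · simpa [h₃] using hp
    · exact absurd (sub_eq_zero.mp h₃) hx
  · intro hz f hf
    have hle : Subgroup.zpowers σ ≤ MulAction.stabilizer (L ≃ₐ[k] L) z := by
      rw [Subgroup.zpowers_le]
      exact hK z hz
    exact hle hf

theorem isIntegral_of_add_mem_of_mul_mem (K : IntermediateField k L) {x y : L}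
    (hsum : x + y ∈ K) (hprod : x * y ∈ K) : IsIntegral K x := by
  refine ⟨Polynomial.X ^ 2 - Polynomial.C ⟨x + y, hsum⟩ * Polynomial.X
    + Polynomial.C ⟨x * y, hprod⟩, by monicity!, ?_⟩
  simp only [Polynomial.eval₂_add, Polynomial.eval₂_sub, Polynomial.eval₂_mul,
    Polynomial.eval₂_pow, Polynomial.eval₂_X, Polynomial.eval₂_C,
    IntermediateField.algebraMap_apply]
  ring

/-- If `L` is algebraic over `k(w)` for a finite family `w` and some family of the same length is
algebraically independent, then so is `w`. -/
theorem algebraicIndependent_of_isAlgebraic_adjoin {ι : Type} [Finite ι] (w : ι → L)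
    (x : ι → L) (hx : AlgebraicIndependent k x)
    [halg : Algebra.IsAlgebraic (IntermediateField.adjoin k (Set.range w)) L] :
    AlgebraicIndependent k w := by
  open scoped IntermediateField.algebraAdjoinAdjoin in
  have : Algebra.IsAlgebraic (Algebra.adjoin k (Set.range w)) L :=
    (IsFractionRing.comap_isAlgebraic_iff (K := IntermediateField.adjoin k (Set.range w))).mpr halg
  exact (Algebra.IsAlgebraic.isTranscendenceBasis_of_lift_le_trdeg_of_finite k w
    hx.lift_cardinalMk_le_trdeg).1

/-- Suppose `L` is generated over `K` by `x` and `y`, and `σ` fixes `K`. If `x * σ x ∈ K` and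
`y * σ y = c (x + σ x) + d` with `c, d ∈ K`, and `K` contains `u = (x - σ x) / (x y - σ x σ y)` and
`v = (y - σ y) / (x y - σ x σ y)`, then `K` is the fixed field of `σ` and `L` is algebraic
over `K`. -/
theorem fixedField_zpowers_eq_of_involution (K : IntermediateField k L) (σ : L ≃ₐ[k] L)
    {x y u v c d : L} (hK : ∀ z ∈ K, σ z = z)
    (ha : x * σ x ∈ K) (hc : c ∈ K) (hd : d ∈ K) (huK : u ∈ K) (hvK : v ∈ K)
    (hx : σ x ≠ x) (hD : x * y - σ x * σ y ≠ 0)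
    (hu : u = (x - σ x) / (x * y - σ x * σ y)) (hv : v = (y - σ y) / (x * y - σ x * σ y))
    (hb : y * σ y = c * (x + σ x) + d) (huv : v + c * u ^ 2 ≠ 0)
    (hgen : ∀ M : IntermediateField K L, x ∈ M → y ∈ M → M = ⊤) :
    IntermediateField.fixedField (Subgroup.zpowers σ) = K ∧ Algebra.IsAlgebraic K L := by
  have hu₀ : u ≠ 0 := by
    rw [hu]
    exact div_ne_zero (sub_ne_zero.mpr hx.symm) hD
  have h₁ : x * v + σ y * u = 1 := by
    rw [hu, hv, mul_div_assoc', mul_div_assoc', ← add_div, div_eq_one_iff_eq hD]; ring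
  have h₂ : σ x * v + y * u = 1 := by
    rw [hu, hv, mul_div_assoc', mul_div_assoc', ← add_div, div_eq_one_iff_eq hD]; ring
  have hs : x + σ x = (1 + x * σ x * v ^ 2 - d * u ^ 2) / (v + c * u ^ 2) := by
    rw [eq_div_iff huv]
    linear_combination (-u ^ 2) * hb + y * u * h₁ + (1 - x * v) * h₂
  have hsum : x + σ x ∈ K := by
    rw [hs]
    exact K.div_mem (K.sub_mem (K.add_mem K.one_mem (K.mul_mem ha (pow_mem hvK 2)))
      (K.mul_mem hd (pow_mem huK 2))) (K.add_mem hvK (K.mul_mem hc (pow_mem huK 2)))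
  have hint := isIntegral_of_add_mem_of_mul_mem K hsum ha
  have htop : IntermediateField.adjoin K {x} = ⊤ := by
    have hKM : ∀ z ∈ K, z ∈ IntermediateField.adjoin K {x} := fun z hz =>
      (IntermediateField.adjoin K {x}).algebraMap_mem ⟨z, hz⟩
    have hxM : x ∈ IntermediateField.adjoin K {x} :=
      IntermediateField.mem_adjoin_simple_self K x
    refine hgen _ hxM ?_
    have hy : y = (1 - ((x + σ x) - x) * v) / u := by
      rw [eq_div_iff hu₀]
      linear_combination h₂
    rw [hy]
    exact div_mem (sub_mem (one_mem _) (mul_mem (sub_mem (hKM _ hsum) hxM) (hKM _ hvK)))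
      (hKM _ huK)
  refine ⟨fixedField_zpowers_eq_of_quadratic_s17 K σ x hK hsum ha hx hint htop, ?_⟩
  have := IntermediateField.isAlgebraic_adjoin_simple hint
  rw [htop] at this
  exact (IntermediateField.topEquiv (F := K) (E := L)).isAlgebraic_iff.mp this

theorem eq_top_of_algebraMap_X_mem {ι : Type*} [Algebra (MvPolynomial ι k) L]
    [IsScalarTower k (MvPolynomial ι k) L] [IsFractionRing (MvPolynomial ι k) L]
    (K : IntermediateField k L) (M : IntermediateField K L)
    (hM : ∀ i, algebraMap (MvPolynomial ι k) L (MvPolynomial.X i) ∈ M) : M = ⊤ := by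
  have hpoly : ∀ p : MvPolynomial ι k, algebraMap (MvPolynomial ι k) L p ∈ M := by
    intro p
    induction p using MvPolynomial.induction_on with
    | C r =>
      rw [← MvPolynomial.algebraMap_eq, ← IsScalarTower.algebraMap_apply]
      exact M.algebraMap_mem (algebraMap k K r)
    | add p q hp hq => rw [map_add]; exact add_mem hp hq
    | mul_X p i hp => rw [map_mul]; exact mul_mem hp (hM i)
  refine eq_top_iff.mpr fun z _ => ?_
  obtain ⟨p, q, -, rfl⟩ := IsFractionRing.div_surjective (A := MvPolynomial ι k) z
  exact div_mem (hpoly p) (hpoly q)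

end

theorem algebraMap_ne_zero_of_eval_ne_zero {ι k L : Type*} [Field k] [Field L]
    [Algebra (MvPolynomial ι k) L] [IsFractionRing (MvPolynomial ι k) L] (w : ι → k)
    {p : MvPolynomial ι k} (hp : MvPolynomial.eval w p ≠ 0) : algebraMap (MvPolynomial ι k) L p ≠ 0 := by
  rw [Ne, IsFractionRing.to_map_eq_zero_iff]
  rintro rfl
  simp at hp

/-- Let `k` be a field with `char k ≠ 2, 3`, let `E, t₂, t₃` be indeterminates, and set
`a = 9E(1 + E)`, `c = −12E`, `d = 4(1 − 9E − 18E²)`.  Let `λ` be the `k(E)`-automorphism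
of `k(E)(t₂,t₃)` with `λ(E) = E`, `λ(t₂) = a/t₂` and `λ(t₃) = (c(t₂ + a/t₂) + d)/t₃`.
Then `k(E)(t₂,t₃)^⟨λ⟩` is rational over `k(E)`; hence `k(E,t₂,t₃)^⟨λ⟩` is purely
transcendental of degree 3 over `k`. -/
theorem stmt_17 (k : Type*) [Field k] (hchar2 : (2 : k) ≠ 0) (hchar3 : (3 : k) ≠ 0)
    (E t₂ t₃ : FractionRing (MvPolynomial (Fin 3) k))
    (hE : E = algebraMap (MvPolynomial (Fin 3) k) _ (MvPolynomial.X 0))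
    (ht₂ : t₂ = algebraMap (MvPolynomial (Fin 3) k) _ (MvPolynomial.X 1))
    (ht₃ : t₃ = algebraMap (MvPolynomial (Fin 3) k) _ (MvPolynomial.X 2))
    (a c d : FractionRing (MvPolynomial (Fin 3) k))
    (ha : a = 9 * E * (1 + E)) (hc : c = -12 * E)
    (hd : d = 4 * (1 - 9 * E - 18 * E ^ 2))
    (lam : FractionRing (MvPolynomial (Fin 3) k) ≃ₐ[k] FractionRing (MvPolynomial (Fin 3) k))
    (hlE : lam E = E) (hl₂ : lam t₂ = a / t₂)
    (hl₃ : lam t₃ = (c * (t₂ + a / t₂) + d) / t₃) :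
    ∃ u v : FractionRing (MvPolynomial (Fin 3) k),
      AlgebraicIndependent k ![E, u, v] ∧
      IntermediateField.adjoin k {E, u, v} =
        IntermediateField.fixedField (Subgroup.zpowers lam) := by
  let P : Fin 3 → MvPolynomial (Fin 3) k := MvPolynomial.X
  have hne : ∀ p : MvPolynomial (Fin 3) k, MvPolynomial.eval ![0, 1, 1] p ≠ 0 →
      algebraMap _ (FractionRing (MvPolynomial (Fin 3) k)) p ≠ 0 :=
    fun p hp => algebraMap_ne_zero_of_eval_ne_zero _ hp
  have hx₀ : t₂ ≠ 0 := ht₂ ▸ hne _ (by simp)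
  have hy₀ : t₃ ≠ 0 := ht₃ ▸ hne _ (by simp)
  have hxa : t₂ ^ 2 - a ≠ 0 := by
    have := hne (P 1 ^ 2 - 9 * P 0 * (1 + P 0)) (by simp [P])
    simpa [P, map_ofNat, ← hE, ← ht₂, ← ha] using this
  have hD₀ : t₂ ^ 3 * t₃ ^ 2 - a * (c * (t₂ ^ 2 + a) + d * t₂) ≠ 0 := by
    have := hne (P 1 ^ 3 * P 2 ^ 2 - 9 * P 0 * (1 + P 0) *
      (-12 * P 0 * (P 1 ^ 2 + 9 * P 0 * (1 + P 0)) +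
        4 * (1 - 9 * P 0 - 18 * P 0 ^ 2) * P 1)) (by simp [P])
    simpa [P, map_ofNat, ← hE, ← ht₂, ← ht₃, ha, hc, hd] using this
  have hR₀ : (t₂ * t₃ ^ 2 - (c * (t₂ ^ 2 + a) + d * t₂)) *
      (t₂ ^ 3 * t₃ ^ 2 - a * (c * (t₂ ^ 2 + a) + d * t₂)) +
      c * t₂ * t₃ ^ 2 * (t₂ ^ 2 - a) ^ 2 ≠ 0 := by
    have := hne ((P 1 * P 2 ^ 2 - (-12 * P 0 * (P 1 ^ 2 + 9 * P 0 * (1 + P 0)) +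
        4 * (1 - 9 * P 0 - 18 * P 0 ^ 2) * P 1)) *
      (P 1 ^ 3 * P 2 ^ 2 - 9 * P 0 * (1 + P 0) *
      (-12 * P 0 * (P 1 ^ 2 + 9 * P 0 * (1 + P 0)) +
        4 * (1 - 9 * P 0 - 18 * P 0 ^ 2) * P 1)) +
      -12 * P 0 * P 1 * P 2 ^ 2 * (P 1 ^ 2 - 9 * P 0 * (1 + P 0)) ^ 2) (by
        have h : (1 : k) - 4 ≠ 0 := fun h => hchar3 (by linear_combination -h)
        simpa [P] using h)
    simpa [P, map_ofNat, ← hE, ← ht₂, ← ht₃, ha, hc, hd] using this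
  have hla : lam a = a := by simp [ha, hlE, map_ofNat]
  have hlc : lam c = c := by simp [hc, hlE, map_ofNat]
  have hld : lam d = d := by simp [hd, hlE, map_ofNat]
  have hprod : t₂ * lam t₂ = a := by rw [hl₂]; field_simp
  have hb : t₃ * lam t₃ = c * (t₂ + lam t₂) + d := by rw [hl₃, hl₂]; field_simp
  have hll₂ : lam (lam t₂) = t₂ := by
    have h := congrArg lam hprod
    rw [map_mul, hla] at h
    exact mul_left_cancel₀ ((map_ne_zero lam).mpr hx₀) (by linear_combination h - hprod)
  have hll₃ : lam (lam t₃) = t₃ := by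
    have h := congrArg lam hb
    rw [map_mul, map_add, map_mul, map_add, hlc, hld, hll₂] at h
    exact mul_left_cancel₀ ((map_ne_zero lam).mpr hy₀) (by linear_combination h - hb)
  have hx : lam t₂ ≠ t₂ := by
    intro h
    rw [h] at hprod
    exact hxa (by linear_combination hprod)
  have hD : t₂ * t₃ - lam t₂ * lam t₃ ≠ 0 := by
    intro h
    rw [hl₂, hl₃] at h
    field_simp at h
    exact hD₀ (by linear_combination h)
  have hR : (t₃ - lam t₃) * (t₂ * t₃ - lam t₂ * lam t₃) + c * (t₂ - lam t₂) ^ 2 ≠ 0 := by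
    intro h
    rw [hl₂, hl₃] at h
    field_simp at h
    exact hR₀ (by linear_combination h)
  obtain ⟨u, hu⟩ : ∃ u, u = (t₂ - lam t₂) / (t₂ * t₃ - lam t₂ * lam t₃) := ⟨_, rfl⟩
  obtain ⟨v, hv⟩ : ∃ v, v = (t₃ - lam t₃) / (t₂ * t₃ - lam t₂ * lam t₃) := ⟨_, rfl⟩
  have hlu : lam u = u := by
    rw [hu, map_div₀, map_sub, map_sub, map_mul, map_mul, hll₂, hll₃, ← neg_div_neg_eq,
      neg_sub, neg_sub]
  have hlv : lam v = v := by
    rw [hv, map_div₀, map_sub, map_sub, map_mul, map_mul, hll₂, hll₃, ← neg_div_neg_eq,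
      neg_sub, neg_sub]
  have huv : v + c * u ^ 2 ≠ 0 := by
    intro h
    have hu' := (eq_div_iff hD).mp hu
    have hv' := (eq_div_iff hD).mp hv
    exact hR (by linear_combination (t₂ * t₃ - lam t₂ * lam t₃) ^ 2 * h -
      (t₂ * t₃ - lam t₂ * lam t₃) * hv' -
      c * (u * (t₂ * t₃ - lam t₂ * lam t₃) + (t₂ - lam t₂)) * hu')
  let K := IntermediateField.adjoin k {E, u, v}
  have hEK : E ∈ K := IntermediateField.subset_adjoin k _ (by simp)
  have huK : u ∈ K := IntermediateField.subset_adjoin k _ (by simp)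
  have hvK : v ∈ K := IntermediateField.subset_adjoin k _ (by simp)
  have hK : ∀ z ∈ K, lam z = z := by
    intro z hz
    induction hz using IntermediateField.adjoin_induction with
    | mem z hz => rcases hz with rfl | rfl | rfl <;> assumption
    | algebraMap r => exact lam.commutes r
    | add _ _ _ _ h₁ h₂ => rw [map_add, h₁, h₂]
    | inv _ _ h => rw [map_inv₀, h]
    | mul _ _ _ _ h₁ h₂ => rw [map_mul, h₁, h₂]
  have haK : a ∈ K := by
    rw [ha]
    exact mul_mem (mul_mem (ofNat_mem K 9) hEK) (add_mem (one_mem K) hEK)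
  have hcK : c ∈ K := by
    rw [hc]
    exact mul_mem (neg_mem (ofNat_mem K 12)) hEK
  have hdK : d ∈ K := by
    rw [hd]
    exact mul_mem (ofNat_mem K 4) (sub_mem (sub_mem (one_mem K) (mul_mem (ofNat_mem K 9) hEK))
      (mul_mem (ofNat_mem K 18) (pow_mem hEK 2)))
  obtain ⟨hfix, halg⟩ := fixedField_zpowers_eq_of_involution K lam hK (hprod ▸ haK) hcK hdK huK hvK
    hx hD hu hv hb huv fun M h₂ h₃ => eq_top_of_algebraMap_X_mem K M (by
      rw [Fin.forall_fin_succ, Fin.forall_fin_two]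
      exact ⟨hE ▸ M.algebraMap_mem ⟨E, hEK⟩, ht₂ ▸ h₂, ht₃ ▸ h₃⟩)
  refine ⟨u, v, ?_, hfix.symm⟩
  have hrange : Set.range ![E, u, v] = {E, u, v} := by
    simp only [Matrix.range_cons, Matrix.range_empty, Set.union_empty, Set.singleton_union]
  have : Algebra.IsAlgebraic (IntermediateField.adjoin k (Set.range ![E, u, v]))
      (FractionRing (MvPolynomial (Fin 3) k)) := by
    rw [hrange]
    exact halg
  refine algebraicIndependent_of_isAlgebraic_adjoin _
    (fun i => algebraMap (MvPolynomial (Fin 3) k) _ (MvPolynomial.X i)) ?_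
  exact (MvPolynomial.algebraicIndependent_X (Fin 3) k).map' (f := IsScalarTower.toAlgHom k _ _)
    (IsFractionRing.injective _ _)
end

section
/- Let k be a field and G a group acting on k(x_1, …, x_n) by k-automorphisms which permute the lines k·x_i up to scalars (monomial linear action), with all σ ∈ G fixing k pointwise. If moreover every σ ∈ G acts ℚ-linearly on ⊕ᵢ ℚxᵢ and fixes x_n up to the action described in Theorem 2.1, then k(x_1, …, x_n)^G = k(x_1/x_n, …, x_{n−1}/x_n)^G(x_0) for some element x_0 fixed by G; i.e., the multiplicative translation structure σ(x_n) ∈ (⊕ᵢ k·(x_i/x_n))·x_n allows splitting off one fixed variable. Concretely: if G ⊆ GL_n(k) acts linearly on k(x_1,…,x_n), then k(x_1,…,x_n)^G = k(x_1/x_n, …, x_{n−1}/x_n)^G(f) for some f with σ(f) = f for all σ ∈ G, and f is transcendental over k(x_1/x_n,…,x_{n−1}/x_n). -/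
set_option synthInstance.maxHeartbeats 1000000
set_option maxHeartbeats 1000000

open IntermediateField

open MvPolynomial

/-- A homogeneous polynomial of degree `m` satisfies `P(x) = P(x / t) * t ^ m`. -/
theorem MvPolynomial.IsHomogeneous.aeval_eq_aeval_div_mul_pow {ι k K : Type*} [Field k] [Field K]
    [Algebra k K] {P : MvPolynomial ι k} {m : ℕ} (hP : P.IsHomogeneous m) (x : ι → K) {t : K}
    (ht : t ≠ 0) :
    MvPolynomial.aeval x P = MvPolynomial.aeval (fun i => x i / t) P * t ^ m := by
  rw [aeval_def, aeval_def, eval₂_eq, eval₂_eq, Finset.sum_mul]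
  refine Finset.sum_congr rfl fun d hd => ?_
  have hdeg : ∑ i ∈ d.support, d i = m := (hP.degree_eq_sum_deg_support hd).symm
  simp_rw [div_pow]
  rw [Finset.prod_div_distrib, Finset.prod_pow_eq_pow_sum, hdeg]
  field_simp

theorem MvPolynomial.homogeneousComponent_aeval_of_isHomogeneous_one {ι τ k : Type*}
    [CommSemiring k] {g : ι → MvPolynomial τ k} (hg : ∀ i, (g i).IsHomogeneous 1)
    (P : MvPolynomial ι k) (m : ℕ) :
    homogeneousComponent m (aeval g P) = aeval g (homogeneousComponent m P) := by
  have hcomp (j : ℕ) : (aeval g (homogeneousComponent j P)).IsHomogeneous j := by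
    simpa using (homogeneousComponent_isHomogeneous j P).aeval g hg
  conv_lhs => rw [← sum_homogeneousComponent P, map_sum, map_sum]
  simp_rw [homogeneousComponent_of_mem (hcomp _)]
  rw [Finset.sum_ite_eq]
  split_ifs with h
  · rfl
  · rw [homogeneousComponent_eq_zero _ _ (by simpa using h), map_zero]

section LinearAction

variable {ι k K : Type*} [Fintype ι] [Field k] [Field K] [Algebra k K] {x : ι → K}

theorem map_aeval_eq_aeval_aeval {σ : K ≃ₐ[k] K} {M : Matrix ι ι k}
    (hM : ∀ j, σ (x j) = ∑ i, algebraMap k K (M i j) * x i) (P : MvPolynomial ι k) :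
    σ (aeval x P) = aeval x (aeval (fun j => ∑ i, C (M i j) * X i) P) := by
  have h : (σ : K →ₐ[k] K).comp (aeval x) =
      (aeval x).comp (aeval (fun j => ∑ i, C (M i j) * X i)) := by
    ext j
    simp [hM]
  exact DFunLike.congr_fun h P

theorem isHomogeneous_one_sum_C_mul_X (M : Matrix ι ι k) (j : ι) :
    (∑ i, C (M i j) * X i : MvPolynomial ι k).IsHomogeneous 1 :=
  IsHomogeneous.sum _ _ _ fun _ _ => isHomogeneous_C_mul_X _ _

theorem map_aeval_homogeneousComponent_eq_self (hx : AlgebraicIndependent k x) {σ : K ≃ₐ[k] K}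
    {M : Matrix ι ι k} (hM : ∀ j, σ (x j) = ∑ i, algebraMap k K (M i j) * x i)
    {P : MvPolynomial ι k} (hP : σ (aeval x P) = aeval x P) (m : ℕ) :
    σ (aeval x (homogeneousComponent m P)) = aeval x (homogeneousComponent m P) := by
  rw [map_aeval_eq_aeval_aeval hM] at hP ⊢
  rw [← homogeneousComponent_aeval_of_isHomogeneous_one (isHomogeneous_one_sum_C_mul_X M),
    hx hP]

end LinearAction

theorem Subgroup.map_prod_apply_eq_self {k K : Type*} [Field k] [Field K] [Algebra k K]
    (G : Subgroup (K ≃ₐ[k] K)) [Fintype G] (z : K) {σ : K ≃ₐ[k] K} (hσ : σ ∈ G) :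
    σ (∏ τ : G, (τ : K ≃ₐ[k] K) z) = ∏ τ : G, (τ : K ≃ₐ[k] K) z := by
  rw [map_prod]
  exact Fintype.prod_equiv (Equiv.mulLeft ⟨σ, hσ⟩) _ _ fun τ => by simp

theorem transcendental_adjoin_div_last {k K : Type*} [Field k] [Field K] [Algebra k K] {n : ℕ}
    {x : Fin (n + 1) → K} (hx : AlgebraicIndependent k x) (htop : adjoin k (Set.range x) = ⊤) :
    Transcendental (adjoin k {z | ∃ i : Fin n, z = x i.castSucc / x (Fin.last n)})
      (x (Fin.last n)) := by
  intro halg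
  set t := x (Fin.last n)
  set s : Set K := {z | ∃ i : Fin n, z = x i.castSucc / t} with hs
  have ht : t ≠ 0 := hx.ne_zero _
  have htop' : (algebraicClosure (adjoin k s) K).restrictScalars k = ⊤ := by
    rw [eq_top_iff, ← htop, adjoin_le_iff]
    rintro _ ⟨i, rfl⟩
    rw [SetLike.mem_coe, IntermediateField.mem_restrictScalars, mem_algebraicClosure_iff]
    induction i using Fin.lastCases with
    | last => exact halg
    | cast i =>
      have h : x i.castSucc / t ∈ adjoin k s := subset_adjoin _ _ ⟨i, rfl⟩
      have h' := (isAlgebraic_algebraMap (A := K) (⟨_, h⟩ : adjoin k s)).mul halg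
      have e : algebraMap (adjoin k s) K ⟨_, h⟩ * t = x i.castSucc := div_mul_cancel₀ _ ht
      rwa [e] at h'
  have : Algebra.IsAlgebraic (adjoin k s) K :=
    ⟨fun z => mem_algebraicClosure_iff.mp
      (show z ∈ (algebraicClosure (adjoin k s) K).restrictScalars k by simp [htop'])⟩
  open scoped IntermediateField.algebraAdjoinAdjoin in
  have : Algebra.IsAlgebraic (Algebra.adjoin k s) K :=
    Algebra.IsAlgebraic.trans _ (adjoin k s) _
  have hle := Algebra.IsAlgebraic.trdeg_le_cardinalMk k s
  have hcard : Cardinal.mk s ≤ n := by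
    have : s = Set.range fun i : Fin n => x i.castSucc / t := by
      ext z; simp [hs, eq_comm]
    rw [this]
    simpa using Cardinal.mk_range_le_lift (f := fun i : Fin n => x i.castSucc / t)
  have hge := hx.lift_cardinalMk_le_trdeg
  simp only [Cardinal.mk_fintype, Fintype.card_fin, Cardinal.lift_natCast,
    Cardinal.lift_id'] at hge
  have := hge.trans (hle.trans hcard)
  norm_cast at this
  omega

theorem exists_fixedField_eq_adjoin_of_linear {k K : Type*} [Field k] [Field K] [Algebra k K]
    {n : ℕ} {x : Fin (n + 1) → K} (hx : AlgebraicIndependent k x)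
    (htop : adjoin k (Set.range x) = ⊤) (G : Subgroup (K ≃ₐ[k] K)) [Finite G]
    (hlin : ∀ σ ∈ G, ∃ M : Matrix (Fin (n + 1)) (Fin (n + 1)) k,
      ∀ j, σ (x j) = ∑ i, algebraMap k K (M i j) * x i)
    (L : IntermediateField k K)
    (hL : L = adjoin k {z | ∃ i : Fin n, z = x i.castSucc / x (Fin.last n)}) :
    ∃ f : K, (∀ σ ∈ G, σ f = f) ∧ Transcendental L f ∧
      fixedField G = adjoin k ((↑L ∩ {z | ∀ σ ∈ G, σ z = z}) ∪ {f}) := by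
  classical
  have := Fintype.ofFinite G
  have htr : Transcendental L (x (Fin.last n)) := hL ▸ transcendental_adjoin_div_last hx htop
  set t := x (Fin.last n) with ht_def
  have ht : t ≠ 0 := hx.ne_zero _
  have hdiv (i) : x i / t ∈ L := by
    induction i using Fin.lastCases with
    | last => rw [← ht_def, div_self ht]; exact one_mem L
    | cast i => rw [hL]; exact subset_adjoin _ _ ⟨i, rfl⟩
  have haeval (P : MvPolynomial (Fin (n + 1)) k) : aeval (fun i => x i / t) P ∈ L := by
    have e : (fun i => x i / t) = fun i => L.val ⟨x i / t, hdiv i⟩ := rfl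
    rw [e, ← comp_aeval_apply]
    exact SetLike.coe_mem _
  have hhom {P : MvPolynomial (Fin (n + 1)) k} {m : ℕ} (hP : P.IsHomogeneous m) :
      ∃ c ∈ L, aeval x P = c * t ^ m :=
    ⟨_, haeval P, hP.aeval_eq_aeval_div_mul_pow x ht⟩
  -- Semi-invariants `c * t ^ d` of positive degree exist: take the norm of `t`.
  have hex : ∃ d : ℕ, 0 < d ∧ ∃ c ∈ L, c ≠ 0 ∧ ∀ σ ∈ G, σ (c * t ^ d) = c * t ^ d := by
    choose M hM using hlin
    have hN : (∏ τ : G, ∑ i, C (M τ τ.2 i (Fin.last n)) * X i).IsHomogeneous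
        (∑ _τ : G, 1) :=
      IsHomogeneous.prod _ _ _ fun τ _ => isHomogeneous_one_sum_C_mul_X _ _
    obtain ⟨c, hc, hct⟩ := hhom hN
    have e : c * t ^ (∑ _τ : G, 1) = ∏ τ : G, (τ : K ≃ₐ[k] K) t := by
      rw [← hct, map_prod]
      refine Finset.prod_congr rfl fun τ _ => ?_
      simp [ht_def, hM τ τ.2]
    refine ⟨∑ _τ : G, 1, by simp [Fintype.card_pos], c, hc, ?_, fun σ hσ => ?_⟩
    · rintro rfl
      rw [zero_mul, eq_comm, Finset.prod_eq_zero_iff] at e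
      obtain ⟨τ, -, h⟩ := e
      exact ht (by simpa using h)
    · rw [e, G.map_prod_apply_eq_self t hσ]
  obtain ⟨hd, c, hcL, hc, hf⟩ := Nat.find_spec hex
  have hmin := fun m => Nat.find_min hex (m := m)
  generalize Nat.find hex = d at hd hf hmin
  refine ⟨c * t ^ d, hf, fun halg => htr ?_, le_antisymm ?_ ?_⟩
  · have h1 : IsAlgebraic L (c⁻¹ * (c * t ^ d)) :=
      (isAlgebraic_algebraMap (A := K) (⟨c⁻¹, inv_mem hcL⟩ : L)).mul halg
    rw [inv_mul_cancel_left₀ hc] at h1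
    exact h1.of_pow hd
  · set E := adjoin k ((↑L ∩ {z | ∀ σ ∈ G, σ z = z}) ∪ {c * t ^ d})
    have hfE : c * t ^ d ∈ E := subset_adjoin _ _ (Or.inr rfl)
    have hmono {b : K} {m : ℕ} (hb : b ∈ L) (hbt : ∀ σ ∈ G, σ (b * t ^ m) = b * t ^ m) :
        b * t ^ m ∈ E := by
      obtain rfl | hb0 := eq_or_ne b 0
      · simp
      set a := b / c ^ (m / d) with ha
      have haL : a ∈ L := div_mem hb (pow_mem hcL _)
      have key : b * t ^ m = a * t ^ (m % d) * (c * t ^ d) ^ (m / d) := by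
        have : t ^ m = t ^ (m % d) * (t ^ d) ^ (m / d) := by
          rw [← pow_mul, ← pow_add, Nat.mod_add_div]
        rw [this, ha, mul_pow]
        field_simp
      have hat : ∀ σ ∈ G, σ (a * t ^ (m % d)) = a * t ^ (m % d) := fun σ hσ => by
        have h := hbt σ hσ
        rw [key, map_mul, map_pow, hf σ hσ] at h
        exact mul_right_cancel₀ (pow_ne_zero _ (mul_ne_zero hc (pow_ne_zero _ ht))) h
      have hr : m % d = 0 := by
        by_contra hr
        exact hmin _ (Nat.mod_lt _ hd) ⟨Nat.pos_of_ne_zero hr, a, haL,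
          div_ne_zero hb0 (pow_ne_zero _ hc), hat⟩
      rw [hr, pow_zero, mul_one] at key hat
      rw [key]
      exact mul_mem (subset_adjoin _ _ (Or.inl ⟨haL, hat⟩)) (pow_mem hfE _)
    have hpoly {P : MvPolynomial (Fin (n + 1)) k} (hP : ∀ σ ∈ G, σ (aeval x P) = aeval x P) :
        aeval x P ∈ E := by
      rw [← sum_homogeneousComponent P, map_sum]
      refine sum_mem fun m _ => ?_
      obtain ⟨b, hb, hbt⟩ := hhom (homogeneousComponent_isHomogeneous m P)
      rw [hbt]
      refine hmono hb fun σ hσ => ?_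
      obtain ⟨M, hM⟩ := hlin σ hσ
      rw [← hbt, map_aeval_homogeneousComponent_eq_self hx hM (hP σ hσ)]
    intro z hz
    have hz' : ∀ σ ∈ G, σ z = z := fun σ hσ => hz ⟨σ, hσ⟩
    obtain ⟨P, Q, hPQ⟩ := (mem_adjoin_range_iff k x z).mp (htop ▸ mem_top)
    by_cases hQ : aeval x Q = 0
    · rw [hPQ, hQ, div_zero]
      exact zero_mem E
    have hrange {σ : K ≃ₐ[k] K} (hσ : σ ∈ G) {R : MvPolynomial (Fin (n + 1)) k} :
        σ (aeval x R) ∈ (aeval (R := k) x).range := by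
      obtain ⟨M, hM⟩ := hlin σ hσ
      exact ⟨_, (map_aeval_eq_aeval_aeval hM R).symm⟩
    -- Multiply numerator and denominator by the conjugates of the denominator.
    set D := ∏ τ : G, (τ : K ≃ₐ[k] K) (aeval x Q) with hD
    have hDfix : ∀ σ ∈ G, σ D = D := fun σ hσ => G.map_prod_apply_eq_self _ hσ
    have hD0 : D ≠ 0 := Finset.prod_ne_zero_iff.mpr fun τ _ => by simpa using hQ
    obtain ⟨B, hB⟩ : D ∈ (aeval (R := k) x).range := prod_mem fun τ _ => hrange τ.2
    obtain ⟨A, hA⟩ : z * D ∈ (aeval (R := k) x).range := by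
      rw [hD, ← Finset.mul_prod_erase _ _ (Finset.mem_univ (1 : G)), ← mul_assoc,
        OneMemClass.coe_one, AlgEquiv.one_apply, hPQ, div_mul_cancel₀ _ hQ]
      exact mul_mem ⟨P, rfl⟩ (prod_mem fun τ _ => hrange τ.2)
    have hBE : D ∈ E := hB ▸ hpoly fun σ hσ => by
      change σ ((aeval x : _ →ₐ[k] K).toRingHom B) = (aeval x : _ →ₐ[k] K).toRingHom B
      rw [hB]; exact hDfix σ hσ
    have hAE : z * D ∈ E := hA ▸ hpoly fun σ hσ => by
      change σ ((aeval x : _ →ₐ[k] K).toRingHom A) = (aeval x : _ →ₐ[k] K).toRingHom A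
      rw [hA, map_mul, hz' σ hσ, hDfix σ hσ]
    have := div_mem hAE hBE
    rwa [mul_div_cancel_right₀ _ hD0] at this
  · rw [adjoin_le_iff]
    rintro z (⟨-, hz⟩ | rfl)
    · exact fun σ => hz σ σ.2
    · exact fun σ => hf σ σ.2

section FractionField

variable {ι k K : Type*} [Field k] [Field K] [Algebra k K] [Algebra (MvPolynomial ι k) K]
  [IsScalarTower k (MvPolynomial ι k) K] {x : ι → K}

theorem aeval_eq_algebraMap_of_forall_eq (hx : ∀ i, x i = algebraMap (MvPolynomial ι k) K (X i))
    (P : MvPolynomial ι k) : aeval x P = algebraMap (MvPolynomial ι k) K P := by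
  obtain rfl : x = algebraMap (MvPolynomial ι k) K ∘ X := funext hx
  rw [aeval_algebraMap_apply, aeval_X_left_apply]

variable [IsFractionRing (MvPolynomial ι k) K]

theorem algebraicIndependent_of_forall_eq_algebraMap_X
    (hx : ∀ i, x i = algebraMap (MvPolynomial ι k) K (X i)) : AlgebraicIndependent k x := by
  intro P Q h
  rw [aeval_eq_algebraMap_of_forall_eq hx, aeval_eq_algebraMap_of_forall_eq hx] at h
  exact IsFractionRing.injective _ _ h

theorem adjoin_range_eq_top_of_forall_eq_algebraMap_X
    (hx : ∀ i, x i = algebraMap (MvPolynomial ι k) K (X i)) : adjoin k (Set.range x) = ⊤ := by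
  refine eq_top_iff.mpr fun z _ => (mem_adjoin_range_iff k x z).mpr ?_
  obtain ⟨P, Q, -, rfl⟩ := IsFractionRing.div_surjective (A := MvPolynomial ι k) z
  exact ⟨P, Q, by simp_rw [aeval_eq_algebraMap_of_forall_eq hx]⟩

end FractionField

/-- Let `G ⊆ GL_n(k)` be a finite group acting linearly on the rational function field
`k(x₁,…,xₙ)`.  Writing `L = k(x₁/xₙ, …, x_{n−1}/xₙ)`, there is an element `f`, fixed by
every `σ ∈ G` and transcendental over `L`, with
`k(x₁,…,xₙ)^G = L^G(f)` (the field generated by the `G`-fixed elements of `L` and `f`). -/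
theorem stmt_19 (k : Type*) [Field k] (n : ℕ)
    (x : Fin (n + 1) → FractionRing (MvPolynomial (Fin (n + 1)) k))
    (hx : ∀ i, x i = algebraMap (MvPolynomial (Fin (n + 1)) k) _ (MvPolynomial.X i))
    (G : Subgroup (FractionRing (MvPolynomial (Fin (n + 1)) k) ≃ₐ[k]
      FractionRing (MvPolynomial (Fin (n + 1)) k))) [Finite G]
    (hlin : ∀ σ ∈ G, ∃ M : Matrix (Fin (n + 1)) (Fin (n + 1)) k, IsUnit M.det ∧
      ∀ j, σ (x j) = ∑ i, algebraMap k _ (M i j) * x i)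
    (L : IntermediateField k (FractionRing (MvPolynomial (Fin (n + 1)) k)))
    (hL : L = IntermediateField.adjoin k
      {z | ∃ i : Fin n, z = x i.castSucc / x (Fin.last n)}) :
    ∃ f : FractionRing (MvPolynomial (Fin (n + 1)) k),
      (∀ σ ∈ G, σ f = f) ∧
      Transcendental L f ∧
      IntermediateField.fixedField G =
        IntermediateField.adjoin k
          ((↑L ∩ {z | ∀ σ ∈ G, σ z = z}) ∪ {f}) := by
  exact exists_fixedField_eq_adjoin_of_linear (algebraicIndependent_of_forall_eq_algebraMap_X hx)
    (adjoin_range_eq_top_of_forall_eq_algebraMap_X hx) G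
    (fun σ hσ => (hlin σ hσ).imp fun _ h => h.2) L hL
end
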